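/- Let R be a Gorenstein local ring. Then G(R)^⊥ = P̃(R): a finitely generated R-module X satisfies Ext^i_R(G,X) = 0 for all totally reflexive modules G and all i > 0 if and only if X has finite projective dimension. -/

import Mathlib

open CategoryTheory

noncomputable section

universe u

variable (R : Type u) [CommRing R]

/-- The `i`-th Ext module of two `R`-modules. -/
abbrev ExtMod (i : ℕ) (M N : ModuleCat.{u} R) : ModuleCat.{u} R :=
  ((Ext R (ModuleCat.{u} R) i).obj (Opposite.op M)).obj N

/-- The `i`-th Tor module of two `R`-modules. -/
abbrev TorMod (i : ℕ) (M N : ModuleCat.{u} R) : ModuleCat.{u} R :=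
  ((Tor' (ModuleCat.{u} R) i).obj M).obj N

/-- `D^⊥`. -/
def perpSet (D : Set (ModuleCat.{u} R)) : Set (ModuleCat.{u} R) :=
  {Y | ∀ X ∈ D, ∀ i : ℕ, 0 < i → Subsingleton (ExtMod R i X Y)}

/-- `E^⊤`. -/
def topSet (E : Set (ModuleCat.{u} R)) : Set (ModuleCat.{u} R) :=
  {X | ∀ Y ∈ E, ∀ i : ℕ, 0 < i → Subsingleton (ExtMod R i X Y)}

/-- depth via maximal lengths of regular sequences in the maximal ideal. -/
def depth [IsLocalRing R] (M : ModuleCat.{u} R) : ℕ :=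
  sSup {n | ∃ rs : List R, rs.length = n ∧ (∀ r ∈ rs, r ∈ IsLocalRing.maximalIdeal R) ∧
    RingTheory.Sequence.IsRegular M rs}

/-- `pd_R M ≤ n` via free syzygies. -/
def ProjDimLE : ℕ → ModuleCat.{u} R → Prop
  | 0, M => Projective M
  | n+1, M => ∃ (K F : ModuleCat.{u} R) (f : K ⟶ F) (g : F ⟶ M) (w : f ≫ g = 0),
      Module.Free R F ∧ (ShortComplex.mk f g w).ShortExact ∧ ProjDimLE n K

/-- Projective dimension, in `ℕ∞`. -/
def projDim (M : ModuleCat.{u} R) : ℕ∞ :=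
  sInf {d : ℕ∞ | ∃ n : ℕ, d = n ∧ ProjDimLE R n M}

/-- Totally reflexive modules. -/
def TotallyReflexive (M : ModuleCat.{u} R) : Prop :=
  Function.Bijective (Module.Dual.eval R M) ∧
  (∀ i : ℕ, 0 < i → Subsingleton (ExtMod R i M (ModuleCat.of R R))) ∧
  (∀ i : ℕ, 0 < i → Subsingleton (ExtMod R i (ModuleCat.of R (Module.Dual R M)) (ModuleCat.of R R)))

/-- `G-dim_R M ≤ n` via syzygies. -/
def GdimLE : ℕ → ModuleCat.{u} R → Prop
  | 0, M => TotallyReflexive R M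
  | n+1, M => ∃ (K F : ModuleCat.{u} R) (f : K ⟶ F) (g : F ⟶ M) (w : f ≫ g = 0),
      Module.Free R F ∧ (ShortComplex.mk f g w).ShortExact ∧ GdimLE n K

/-- Gorenstein dimension, in `ℕ∞`. -/
def Gdim (M : ModuleCat.{u} R) : ℕ∞ :=
  sInf {d : ℕ∞ | ∃ n : ℕ, d = n ∧ GdimLE R n M}

/-- `M` is an `n`-th syzygy module. -/
def IsNthSyzygy : ℕ → ModuleCat.{u} R → Prop
  | 0, _ => True
  | n+1, M => ∃ (F C : ModuleCat.{u} R) (f : M ⟶ F) (g : F ⟶ C) (w : f ≫ g = 0),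
      Module.Free R F ∧ (ShortComplex.mk f g w).ShortExact ∧ IsNthSyzygy n C

/-- `syz_R M`: the largest `t ≤ depth R` such that `M` is a `t`-th syzygy. -/
def syz [IsLocalRing R] (M : ModuleCat.{u} R) : ℕ :=
  sSup {t | t ≤ depth R (ModuleCat.of R R) ∧ IsNthSyzygy R t M}

/-- Complexity of a sequence of natural numbers. -/
def seqComplexity (b : ℕ → ℕ) : ℕ :=
  sInf {r : ℕ | ∃ α : ℝ, ∀ᶠ n in Filter.atTop, (b n : ℝ) ≤ α * (n : ℝ) ^ ((r : ℝ) - 1)}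

/-- Minimal number of generators. -/
def numGen (M : ModuleCat.{u} R) : ℕ :=
  sInf {n | ∃ s : Finset M, s.card = n ∧ Submodule.span R (s : Set M) = ⊤}

/-- Complexity of a pair of modules. -/
def cx (M N : ModuleCat.{u} R) : ℕ :=
  seqComplexity (fun i => numGen R (ExtMod R i M N))

/-- Regular local ring: Noetherian local, maximal ideal generated by a regular sequence. -/
def IsRegularLocal (Q : Type u) [CommRing Q] : Prop :=
  IsLocalRing Q ∧ IsNoetherianRing Q ∧
  ∃ rs : List Q, RingTheory.Sequence.IsRegular Q rs ∧ (Ideal.span {x | x ∈ rs}).IsMaximal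

/-- Local complete intersection ring: the completion is a regular local ring
modulo a regular sequence. -/
def IsCompleteIntersectionLocal (R : Type u) [CommRing R] [IsLocalRing R] : Prop :=
  ∃ (Q : CommRingCat.{u})
    (φ : ↥Q →+* AdicCompletion (IsLocalRing.maximalIdeal R) R),
    IsRegularLocal ↥Q ∧ Function.Surjective φ ∧
    ∃ rs : List ↥Q, RingTheory.Sequence.IsRegular (↥Q) rs ∧
      RingHom.ker φ = Ideal.span {x | x ∈ rs}

/-- Gorenstein local ring: `R` has finite injective dimension over itself,
expressed via eventual vanishing of `Ext^i(-, R)`. -/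
def IsGorensteinLocal (R : Type u) [CommRing R] : Prop :=
  IsLocalRing R ∧ IsNoetherianRing R ∧
  ∃ n : ℕ, ∀ (M : ModuleCat.{u} R) (i : ℕ), n < i → Subsingleton (ExtMod R i M (ModuleCat.of R R))

namespace CategoryTheory.ShortComplex.ShortExact

variable {C : Type*} [Category* C] [Abelian C] [HasExt C] {S : ShortComplex C}

lemma subsingleton_ext_X₁ (hS : S.ShortExact) {Y : C} {n : ℕ}
    (h₂ : Subsingleton (Abelian.Ext S.X₂ Y n)) (h₃ : Subsingleton (Abelian.Ext S.X₃ Y (n + 1))) :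
    Subsingleton (Abelian.Ext S.X₁ Y n) := by
  refine subsingleton_of_forall_eq 0 fun x ↦ ?_
  obtain ⟨y, rfl⟩ := Abelian.Ext.contravariant_sequence_exact₁ hS Y x (add_comm 1 n)
    (Subsingleton.elim _ _)
  rw [Subsingleton.elim y 0, Abelian.Ext.comp_zero]

lemma subsingleton_ext_from_X₁ (hS : S.ShortExact) {Y : C} {n : ℕ}
    (h₂ : Subsingleton (Abelian.Ext Y S.X₂ (n + 1))) (h₃ : Subsingleton (Abelian.Ext Y S.X₃ n)) :
    Subsingleton (Abelian.Ext Y S.X₁ (n + 1)) := by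
  refine subsingleton_of_forall_eq 0 fun x ↦ ?_
  obtain ⟨y, rfl⟩ := Abelian.Ext.covariant_sequence_exact₁ Y hS x (Subsingleton.elim _ _) rfl
  rw [Subsingleton.elim y 0, Abelian.Ext.zero_comp]

lemma subsingleton_ext_from_X₃ (hS : S.ShortExact) {Y : C} {n : ℕ}
    (h₁ : Subsingleton (Abelian.Ext Y S.X₁ (n + 1))) (h₂ : Subsingleton (Abelian.Ext Y S.X₂ n)) :
    Subsingleton (Abelian.Ext Y S.X₃ n) := by
  refine subsingleton_of_forall_eq 0 fun x ↦ ?_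
  obtain ⟨y, rfl⟩ := Abelian.Ext.covariant_sequence_exact₃ Y hS x rfl (Subsingleton.elim _ _)
  rw [Subsingleton.elim y 0, Abelian.Ext.zero_comp]

end CategoryTheory.ShortComplex.ShortExact

lemma subsingleton_ext_of_projective {C : Type*} [Category* C] [Abelian C] [HasExt C]
    {P Y : C} [Projective P] (n : ℕ) : Subsingleton (Abelian.Ext P Y (n + 1)) :=
  subsingleton_of_forall_eq 0 fun x ↦ x.eq_zero_of_projective

section

variable {R}

lemma subsingleton_extMod_succ_iff (M N : ModuleCat.{u} R) (n : ℕ) :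
    Subsingleton (ExtMod R (n + 1) M N) ↔ Subsingleton (Abelian.Ext M N (n + 1)) := by
  let P := ProjectiveResolution.of M
  have key : Subsingleton (ExtMod R (n + 1) M N) ↔
      ∀ f : P.complex.X (n + 1) ⟶ N, P.complex.d (n + 2) (n + 1) ≫ f = 0 →
        ∃ g : P.complex.X n ⟶ N, P.complex.d (n + 1) n ≫ g = f := by
    rw [← ModuleCat.isZero_iff_subsingleton, (P.isoExt (n + 1) N).isZero_iff,
      ← HomologicalComplex.exactAt_iff_isZero_homology,
      HomologicalComplex.exactAt_iff' _ n (n + 1) (n + 2) (by simp) (by simp),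
      ShortComplex.moduleCat_exact_iff]
    rfl
  rw [key]
  constructor
  · intro h
    refine subsingleton_of_forall_eq 0 fun x ↦ ?_
    obtain ⟨f, hf, rfl⟩ := P.extMk_surjective x (n + 2) rfl
    exact (P.extMk_eq_zero_iff f _ rfl hf n rfl).2 (h f hf)
  · intro h f hf
    exact (P.extMk_eq_zero_iff f _ rfl hf n rfl).1 (Subsingleton.elim _ _)

lemma subsingleton_extMod_iff (M N : ModuleCat.{u} R) {i : ℕ} (hi : 0 < i) :
    Subsingleton (ExtMod R i M N) ↔ Subsingleton (Abelian.Ext M N i) := by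
  obtain ⟨n, rfl⟩ := Nat.exists_eq_succ_of_ne_zero hi.ne'
  exact subsingleton_extMod_succ_iff M N n

/-- A finitely generated module is the quotient of a finitely generated free module. -/
lemma exists_shortExact_finite_free (M : ModuleCat.{u} R) [Module.Finite R M] :
    ∃ S : ShortComplex (ModuleCat.{u} R), S.ShortExact ∧ S.X₃ = M ∧
      Module.Free R S.X₂ ∧ Module.Finite R S.X₂ := by
  obtain ⟨n, f, hf⟩ := Module.Finite.exists_fin' R M
  exact ⟨_, LinearMap.shortExact_shortComplexKer hf, rfl,
    inferInstanceAs (Module.Free R (Fin n → R)), inferInstanceAs (Module.Finite R (Fin n → R))⟩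

lemma CategoryTheory.ShortComplex.ShortExact.finite_X₁ [IsNoetherianRing R]
    {S : ShortComplex (ModuleCat.{u} R)} (hS : S.ShortExact) [Module.Finite R S.X₂] :
    Module.Finite R S.X₁ :=
  Module.Finite.of_injective S.f.hom hS.moduleCat_injective_f

lemma finite_dual [IsNoetherianRing R] (M : Type*) [AddCommGroup M] [Module R M]
    [Module.Finite R M] : Module.Finite R (Module.Dual R M) := by
  obtain ⟨n, f, hf⟩ := Module.Finite.exists_fin' R M
  exact Module.Finite.of_injective f.dualMap (LinearMap.dualMap_injective_of_surjective hf)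

instance ModuleCat.projective_of_free_module (M : ModuleCat.{u} R) [Module.Free R M] :
    Projective M :=
  (IsProjective.iff_projective M).1 (Module.Projective.of_free)

/-- A module `M` with `Ext^i(M, R) = 0` for all `i > 0`. -/
def ExtAcyclic (M : ModuleCat.{u} R) : Prop :=
  ∀ i : ℕ, Subsingleton (Abelian.Ext M (ModuleCat.of R R) (i + 1))

/-- The dual of a module, as an object of the category of modules. -/
abbrev dualObj (M : ModuleCat.{u} R) : ModuleCat.{u} R :=
  ModuleCat.of R (Module.Dual R M)

/-- The dual of a short complex of modules. -/
abbrev dualShortComplex (S : ShortComplex (ModuleCat.{u} R)) : ShortComplex (ModuleCat.{u} R) where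
  X₁ := dualObj S.X₃
  X₂ := dualObj S.X₂
  X₃ := dualObj S.X₁
  f := ModuleCat.ofHom S.g.hom.dualMap
  g := ModuleCat.ofHom S.f.hom.dualMap
  zero := by
    ext φ x
    change φ (S.g (S.f x)) = 0
    simp

lemma shortExact_dualShortComplex {S : ShortComplex (ModuleCat.{u} R)} (hS : S.ShortExact)
    (h : Subsingleton (Abelian.Ext S.X₃ (ModuleCat.of R R) 1)) :
    (dualShortComplex S).ShortExact where
  exact := by
    rw [ShortComplex.moduleCat_exact_iff]
    intro (φ : Module.Dual R S.X₂) hφ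
    have hφ : S.f ≫ ModuleCat.ofHom φ = 0 := by
      ext x
      exact LinearMap.congr_fun hφ x
    have := hS.epi_g
    refine ⟨(hS.exact.desc (ModuleCat.ofHom φ) hφ).hom, ?_⟩
    exact congr_arg ModuleCat.Hom.hom (hS.exact.g_desc (ModuleCat.ofHom φ) hφ)
  mono_f := (ModuleCat.mono_iff_injective _).2
    (LinearMap.dualMap_injective_of_surjective hS.moduleCat_surjective_g)
  epi_g := by
    rw [ModuleCat.epi_iff_surjective]
    intro (φ : Module.Dual R S.X₁)
    obtain ⟨y, hy⟩ := Abelian.Ext.contravariant_sequence_exact₁ hS (ModuleCat.of R R)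
      (Abelian.Ext.mk₀ (ModuleCat.ofHom φ)) (add_zero 1) (Subsingleton.elim _ _)
    obtain ⟨ψ, rfl⟩ := Abelian.Ext.addEquiv₀.symm.surjective y
    refine ⟨ψ.hom, ?_⟩
    have : S.f ≫ ψ = ModuleCat.ofHom φ := by
      apply Abelian.Ext.addEquiv₀.symm.injective
      simpa using hy
    exact congr_arg ModuleCat.Hom.hom this

namespace ExtAcyclic

lemma X₁ {S : ShortComplex (ModuleCat.{u} R)} (hS : S.ShortExact) [Projective S.X₂]
    (h : ExtAcyclic S.X₃) : ExtAcyclic S.X₁ := fun i ↦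
  hS.subsingleton_ext_X₁ (subsingleton_ext_of_projective i) (h (i + 1))

variable [IsNoetherianRing R]

/-- Over a ring of finite self-injective dimension, duals of `Ext`-acyclic modules are
`Ext`-acyclic. -/
lemma dual {n : ℕ}
    (hn : ∀ (M : ModuleCat.{u} R) (i : ℕ), n < i →
      Subsingleton (Abelian.Ext M (ModuleCat.of R R) i))
    {M : ModuleCat.{u} R} [Module.Finite R M] (hM : ExtAcyclic M) : ExtAcyclic (dualObj M) := by
  suffices ∀ (k : ℕ) (M : ModuleCat.{u} R), Module.Finite R M → ExtAcyclic M → ∀ i, n ≤ i + k →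
      Subsingleton (Abelian.Ext (dualObj M) (ModuleCat.of R R) (i + 1)) from
    fun i ↦ this n M inferInstance hM i (Nat.le_add_left n i)
  intro k
  induction k with
  | zero => exact fun M _ _ i hi ↦ hn _ _ (Nat.lt_succ_of_le hi)
  | succ k ih =>
    intro M _ hM i hi
    obtain ⟨S, hS, rfl, _, _⟩ := exists_shortExact_finite_free M
    have := hS.finite_X₁
    have : Projective (dualShortComplex S).X₂ :=
      ModuleCat.projective_of_free_module (dualObj S.X₂)
    exact (shortExact_dualShortComplex hS (hM 0)).subsingleton_ext_X₁
      (subsingleton_ext_of_projective i)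
      (ih _ inferInstance (hM.X₁ hS) (i + 1) (by lia))

/-- Over a ring of finite self-injective dimension, `Ext`-acyclic modules are reflexive. -/
lemma bijective_eval {n : ℕ}
    (hn : ∀ (M : ModuleCat.{u} R) (i : ℕ), n < i →
      Subsingleton (Abelian.Ext M (ModuleCat.of R R) i))
    {M : ModuleCat.{u} R} [Module.Finite R M] (hM : ExtAcyclic M) :
    Function.Bijective (Module.Dual.eval R M) := by
  have surj : ∀ (M : ModuleCat.{u} R), Module.Finite R M → ExtAcyclic M →
      Function.Surjective (Module.Dual.eval R M) := by
    intro M _ hM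
    obtain ⟨S, hS, rfl, _, _⟩ := exists_shortExact_finite_free M
    have := hS.finite_X₁
    have hS' := shortExact_dualShortComplex (shortExact_dualShortComplex hS (hM 0))
      ((hM.X₁ hS).dual hn 0)
    intro x
    obtain ⟨y, rfl⟩ := hS'.moduleCat_surjective_g x
    obtain ⟨z, rfl⟩ := (Module.bijective_dual_eval R S.X₂).2 y
    exact ⟨S.g z, rfl⟩
  refine ⟨?_, surj M inferInstance hM⟩
  obtain ⟨S, hS, rfl, _, _⟩ := exists_shortExact_finite_free M
  have := hS.finite_X₁
  have hS' := shortExact_dualShortComplex (shortExact_dualShortComplex hS (hM 0))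
    ((hM.X₁ hS).dual hn 0)
  rw [injective_iff_map_eq_zero]
  intro x hx
  obtain ⟨y, rfl⟩ := hS.moduleCat_surjective_g x
  obtain ⟨z, hz⟩ := (ShortComplex.moduleCat_exact_iff _).1 hS'.exact (Module.Dual.eval R S.X₂ y) hx
  obtain ⟨w, rfl⟩ := surj S.X₁ inferInstance (hM.X₁ hS) z
  have : S.f w = y := (Module.bijective_dual_eval R S.X₂).1 hz
  rw [← this]
  simp

lemma totallyReflexive {n : ℕ}
    (hn : ∀ (M : ModuleCat.{u} R) (i : ℕ), n < i →
      Subsingleton (Abelian.Ext M (ModuleCat.of R R) i))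
    {M : ModuleCat.{u} R} [Module.Finite R M] (hM : ExtAcyclic M) : TotallyReflexive R M := by
  refine ⟨hM.bijective_eval hn, fun i hi ↦ ?_, fun i hi ↦ ?_⟩ <;>
    rw [subsingleton_extMod_iff _ _ hi] <;> obtain ⟨i, rfl⟩ := Nat.exists_eq_succ_of_ne_zero hi.ne'
  exacts [hM i, hM.dual hn i]

/-- Over a ring of finite self-injective dimension, `Ext`-acyclic modules are syzygies of
`Ext`-acyclic modules. -/
lemma exists_cosyzygy {n : ℕ}
    (hn : ∀ (M : ModuleCat.{u} R) (i : ℕ), n < i →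
      Subsingleton (Abelian.Ext M (ModuleCat.of R R) i))
    {M : ModuleCat.{u} R} [Module.Finite R M] (hM : ExtAcyclic M) :
    ∃ (F N : ModuleCat.{u} R) (f : M ⟶ F) (g : F ⟶ N) (w : f ≫ g = 0),
      (ShortComplex.mk f g w).ShortExact ∧ Module.Free R F ∧ Module.Finite R N ∧
        ExtAcyclic N := by
  have : Module.Finite R (dualObj M) := finite_dual M
  obtain ⟨S, hS, h₃, _, _⟩ := exists_shortExact_finite_free (dualObj M)
  have := hS.finite_X₁
  have hS₃ : ExtAcyclic S.X₃ := h₃ ▸ hM.dual hn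
  have hS' := shortExact_dualShortComplex hS (hS₃ 0)
  let e : M ≅ (dualShortComplex S).X₁ :=
    (LinearEquiv.ofBijective _ (hM.bijective_eval hn)).toModuleIso ≪≫
      eqToIso (congr_arg dualObj h₃.symm)
  refine ⟨_, _, e.hom ≫ (dualShortComplex S).f, (dualShortComplex S).g,
    by rw [Category.assoc, (dualShortComplex S).zero, Limits.comp_zero], ?_,
    inferInstanceAs (Module.Free R (Module.Dual R S.X₂)),
    finite_dual S.X₁, (hS₃.X₁ hS).dual hn⟩
  exact ShortComplex.shortExact_of_iso
    (ShortComplex.isoMk e.symm (Iso.refl _) (Iso.refl _) (by simp) (by simp)) hS'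

end ExtAcyclic

lemma TotallyReflexive.extAcyclic {M : ModuleCat.{u} R} (hM : TotallyReflexive R M) :
    ExtAcyclic M := fun i ↦
  (subsingleton_extMod_succ_iff _ _ i).1 (hM.2.1 (i + 1) i.succ_pos)

lemma ExtAcyclic.subsingleton_ext_of_projective {G : ModuleCat.{u} R} (hG : ExtAcyclic G)
    (P : ModuleCat.{u} R) [Module.Finite R P] [Module.Projective R P] (i : ℕ) :
    Subsingleton (Abelian.Ext G P (i + 1)) := by
  obtain ⟨m, f, g, -, -, hfg⟩ := Module.Finite.exists_comp_eq_id_of_projective R P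
  let p (j : Fin m) : P ⟶ ModuleCat.of R R := ModuleCat.ofHom (LinearMap.proj j ∘ₗ g)
  let s (j : Fin m) : ModuleCat.of R R ⟶ P :=
    ModuleCat.ofHom (f ∘ₗ LinearMap.single R (fun _ ↦ R) j)
  have hps : ∑ j, p j ≫ s j = 𝟙 P := by
    ext x
    have h : f (∑ j, Pi.single j (g x j)) = x := by
      rw [Finset.univ_sum_single]
      exact LinearMap.congr_fun hfg x
    simpa [p, s, ModuleCat.hom_sum] using h
  refine subsingleton_of_forall_eq 0 fun x ↦ ?_
  rw [← x.comp_mk₀_id, ← hps, Abelian.Ext.mk₀_sum, Abelian.Ext.comp_sum]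
  refine Finset.sum_eq_zero fun j _ ↦ ?_
  have := hG i
  rw [← Abelian.Ext.mk₀_comp_mk₀, ← Abelian.Ext.comp_assoc_of_second_deg_zero,
    Subsingleton.elim (x.comp (Abelian.Ext.mk₀ (p j)) (add_zero _)) 0, Abelian.Ext.zero_comp]

lemma ProjDimLE.hasProjectiveDimensionLE {n : ℕ} {X : ModuleCat.{u} R} (h : ProjDimLE R n X) :
    HasProjectiveDimensionLE X n := by
  induction n generalizing X with
  | zero => exact (projective_iff_hasProjectiveDimensionLE_zero X).1 h
  | succ n ih =>
    obtain ⟨K, F, f, g, w, hF, hS, hK⟩ := h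
    exact (hS.hasProjectiveDimensionLT_X₃_iff n (ModuleCat.projective_of_free_module F)).2 (ih hK)

lemma projDim_ne_top_iff (X : ModuleCat.{u} R) : projDim R X ≠ ⊤ ↔ ∃ n, ProjDimLE R n X := by
  rw [projDim, Ne, sInf_eq_top]
  push Not
  constructor
  · rintro ⟨_, ⟨n, -, hn⟩, -⟩
    exact ⟨n, hn⟩
  · rintro ⟨n, hn⟩
    exact ⟨n, ⟨n, rfl, hn⟩, ENat.natCast_ne_top n⟩

variable [IsNoetherianRing R]

lemma ExtAcyclic.subsingleton_ext {G : ModuleCat.{u} R} (hG : ExtAcyclic G) {n : ℕ}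
    {X : ModuleCat.{u} R} [Module.Finite R X] (hX : HasProjectiveDimensionLE X n) (i : ℕ) :
    Subsingleton (Abelian.Ext G X (i + 1)) := by
  induction n generalizing X i with
  | zero =>
    have := (projective_iff_hasProjectiveDimensionLE_zero X).2 hX
    have : Module.Projective R X := (IsProjective.iff_projective X).2 this
    exact hG.subsingleton_ext_of_projective X i
  | succ n ih =>
    obtain ⟨S, hS, rfl, _, _⟩ := exists_shortExact_finite_free X
    have := hS.finite_X₁
    exact hS.subsingleton_ext_from_X₃
      (ih ((hS.hasProjectiveDimensionLT_X₃_iff n inferInstance).1 hX) (i + 1))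
      (hG.subsingleton_ext_of_projective S.X₂ i)

lemma projDimLE_of_subsingleton_ext {n : ℕ}
    (hn : ∀ (M : ModuleCat.{u} R) (i : ℕ), n < i →
      Subsingleton (Abelian.Ext M (ModuleCat.of R R) i))
    (k : ℕ) {X : ModuleCat.{u} R} [Module.Finite R X]
    (hk : ∀ i, k < i → Subsingleton (Abelian.Ext X (ModuleCat.of R R) i))
    (hX : ∀ G : ModuleCat.{u} R, Module.Finite R G → ExtAcyclic G →
      ∀ i, Subsingleton (Abelian.Ext G X (i + 1))) :
    ProjDimLE R k X := by
  induction k generalizing X with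
  | zero =>
    have hXa : ExtAcyclic X := fun i ↦ hk _ i.succ_pos
    obtain ⟨F, N, f, g, w, hS, _, hN, hNa⟩ := hXa.exists_cosyzygy hn
    have := hX N hN hNa 0
    obtain ⟨y, hy⟩ := Abelian.Ext.contravariant_sequence_exact₁ hS X
      (Abelian.Ext.mk₀ (𝟙 X)) (add_zero 1) (Subsingleton.elim _ _)
    obtain ⟨r, rfl⟩ := Abelian.Ext.addEquiv₀.symm.surjective y
    have hr : f ≫ r = 𝟙 X := by
      apply Abelian.Ext.addEquiv₀.symm.injective
      simpa using hy
    exact (Retract.mk f r hr).projective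
  | succ k ih =>
    obtain ⟨S, hS, rfl, hF, _⟩ := exists_shortExact_finite_free X
    have := hS.finite_X₁
    refine ⟨S.X₁, S.X₂, S.f, S.g, S.zero, hF, hS, ih (fun i hi ↦ ?_) fun G _ hG i ↦ ?_⟩
    · obtain ⟨i, rfl⟩ := Nat.exists_eq_succ_of_ne_zero (Nat.zero_lt_of_lt hi).ne'
      exact hS.subsingleton_ext_X₁ (subsingleton_ext_of_projective i)
        (hk _ (Nat.succ_lt_succ hi))
    · obtain ⟨F, N, f, g, w, hT, _, hN, hNa⟩ := hG.exists_cosyzygy hn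
      exact hT.subsingleton_ext_X₁ (subsingleton_ext_of_projective i)
        (hS.subsingleton_ext_from_X₁ (hNa.subsingleton_ext_of_projective S.X₂ (i + 1))
          (hX N hN hNa i))

end

theorem stmt4 (R : Type u) [CommRing R] [IsNoetherianRing R] [IsLocalRing R]
    (hgor : IsGorensteinLocal R)
    (X : ModuleCat.{u} R) (hfg : Module.Finite R X) :
    (∀ G : ModuleCat.{u} R, Module.Finite R G → TotallyReflexive R G →
        ∀ i : ℕ, 0 < i → Subsingleton (ExtMod R i G X)) ↔ projDim R X ≠ ⊤ := by
  obtain ⟨-, -, n, hn⟩ := hgor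
  replace hn : ∀ (M : ModuleCat.{u} R) (i : ℕ), n < i →
      Subsingleton (Abelian.Ext M (ModuleCat.of R R) i) := fun M i hi ↦
    (subsingleton_extMod_iff _ _ (Nat.zero_lt_of_lt hi)).1 (hn M i hi)
  rw [projDim_ne_top_iff]
  constructor
  · intro h
    exact ⟨n, projDimLE_of_subsingleton_ext hn n (fun i hi ↦ hn X i hi) fun G hG hGa i ↦
      (subsingleton_extMod_succ_iff G X i).1
        (h G hG (hGa.totallyReflexive hn) (i + 1) i.succ_pos)⟩
  · rintro ⟨m, hm⟩ G _ hG i hi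
    obtain ⟨i, rfl⟩ := Nat.exists_eq_succ_of_ne_zero hi.ne'
    exact (subsingleton_extMod_succ_iff G X i).2
      (hG.extAcyclic.subsingleton_ext hm.hasProjectiveDimensionLE i)

end
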